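/- Suppose X satisfies Assumption 2, and let T : (0, ∞) → (0, ∞) satisfy T_u/u → 0 as u → ∞ (T_u = o(u)). Then (1/u) · log P(Q_e + Y̲(T_u) > u) → −ϑ* as u → ∞. -/

import Mathlib

open MeasureTheory ProbabilityTheory Filter Set

lemma aux_max {Ω : Type*} [MeasurableSpace Ω] {μ : Measure Ω} [IsProbabilityMeasure μ]
    {G : Filtration ℕ ‹MeasurableSpace Ω›} {f : ℕ → Ω → ℝ} (hf : Submartingale f G μ)
    (h0 : 0 ≤ f) {a : ℝ} (ha : 0 < a) (n : ℕ) :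
    μ {ω | ∃ k ≤ n, a ≤ f k ω} ≤ ENNReal.ofReal ((∫ ω, f n ω ∂μ) / a) := by
  lift a to NNReal using ha.le
  have h := maximal_ineq hf h0 (ε := a) n
  have hs : {ω | (a : ℝ) ≤ (Finset.range (n + 1)).sup' Finset.nonempty_range_add_one
      fun k => f k ω} = {ω | ∃ k ≤ n, (a : ℝ) ≤ f k ω} := by
    ext ω
    simp [Finset.le_sup'_iff]
  simp only [hs] at h
  have h2 : ∫ ω in {ω | ∃ k ≤ n, (a : ℝ) ≤ f k ω}, f n ω ∂μ ≤ ∫ ω, f n ω ∂μ :=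
    setIntegral_le_integral (hf.integrable n) (Eventually.of_forall fun ω => h0 n ω)
  rw [ENNReal.ofReal_div_of_pos ha]
  rw [ENNReal.le_div_iff_mul_le (Or.inl (by simpa using ha.ne')) (Or.inl (by simp)), mul_comm]
  refine le_trans ?_ (h.trans (ENNReal.ofReal_le_ofReal h2))
  simp

lemma aux_prod_mart {Ω : Type*} [MeasurableSpace Ω] {μ : Measure Ω} [IsProbabilityMeasure μ]
    {ζ : ℕ → Ω → ℝ} (hm : ∀ i, StronglyMeasurable (ζ i)) (hi : iIndepFun ζ μ)
    (hint : ∀ i, Integrable (ζ i) μ) (h1 : ∀ i, ∫ ω, ζ i ω ∂μ = 1) :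
    Martingale (fun j => ∏ i ∈ Finset.range (j + 1), ζ i) (Filtration.natural ζ hm) μ := by
  have hmm : ∀ i, Measurable (ζ i) := fun i => (hm i).measurable
  have hI : ∀ j, Integrable (∏ i ∈ Finset.range (j + 1), ζ i) μ := by
    intro j
    induction j with
    | zero => simpa using hint 0
    | succ j ih =>
      rw [Finset.prod_range_succ]
      exact (hi.indepFun_prod_range_succ hmm (j+1)).integrable_mul ih (hint _)
  have had : StronglyAdapted (Filtration.natural ζ hm) (fun j => ∏ i ∈ Finset.range (j + 1), ζ i) := by
    intro j
    refine Finset.stronglyMeasurable_prod _ fun i hi => ?_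
    exact ((Filtration.stronglyAdapted_natural hm) i).mono
      ((Filtration.natural ζ hm).mono (by simpa [Nat.lt_succ_iff] using hi))
  refine martingale_nat had hI fun j => ?_
  rw [Finset.prod_range_succ _ (j+1)]
  have := condExp_mul_of_stronglyMeasurable_left (μ := μ) (had j) (g := ζ (j+1))
    (by rw [← Finset.prod_range_succ]; exact hI (j+1)) (hint _)
  refine EventuallyEq.trans ?_ this.symm
  filter_upwards [hi.condExp_natural_ae_eq_of_lt hm (Nat.lt_succ_self j)] with ω hω
  simp only [Pi.mul_apply]
  rw [hω, h1, mul_one]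

lemma aux_sum_mart {Ω : Type*} [MeasurableSpace Ω] {μ : Measure Ω} [IsProbabilityMeasure μ]
    {ζ : ℕ → Ω → ℝ} (hm : ∀ i, StronglyMeasurable (ζ i)) (hi : iIndepFun ζ μ)
    (hint : ∀ i, Integrable (ζ i) μ) (h1 : ∀ i, ∫ ω, ζ i ω ∂μ = 0) :
    Martingale (fun j => ∑ i ∈ Finset.range (j + 1), ζ i) (Filtration.natural ζ hm) μ := by
  have hI : ∀ j, Integrable (∑ i ∈ Finset.range (j + 1), ζ i) μ := by
    intro j
    exact integrable_finsetSum' _ fun i _ => hint i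
  have had : StronglyAdapted (Filtration.natural ζ hm) (fun j => ∑ i ∈ Finset.range (j + 1), ζ i) := by
    intro j
    refine Finset.stronglyMeasurable_sum _ fun i hi => ?_
    exact ((Filtration.stronglyAdapted_natural hm) i).mono
      ((Filtration.natural ζ hm).mono (by simpa [Nat.lt_succ_iff] using hi))
  refine martingale_nat had hI fun j => ?_
  rw [Finset.sum_range_succ _ (j+1)]
  have := condExp_add (hI j) (hint (j+1)) (Filtration.natural ζ hm j)
  refine EventuallyEq.trans ?_ this.symm
  rw [condExp_of_stronglyMeasurable (Filtration.le _ _) (had j) (hI j)]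
  filter_upwards [hi.condExp_natural_ae_eq_of_lt hm (Nat.lt_succ_self j)] with ω hω
  simp only [Pi.add_apply]
  rw [hω, h1, add_zero]

/-- Ville for random walks. -/
lemma aux_ville {Ω : Type*} [MeasurableSpace Ω] {μ : Measure Ω} [IsProbabilityMeasure μ]
    {ξ : ℕ → Ω → ℝ} (hm : ∀ i, Measurable (ξ i)) (hi : iIndepFun ξ μ) {θ : ℝ} (hθ : 0 < θ)
    (hint : ∀ i, Integrable (fun ω => Real.exp (θ * ξ i ω)) μ)
    (h1 : ∀ i, ∫ ω, Real.exp (θ * ξ i ω) ∂μ = 1) (u : ℝ) (n : ℕ) :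
    μ {ω | ∃ k ≤ n, u ≤ ∑ i ∈ Finset.range (k + 1), ξ i ω} ≤ ENNReal.ofReal (Real.exp (-θ * u)) := by
  have hM := aux_prod_mart (μ := μ) (ζ := fun i ω => Real.exp (θ * ξ i ω))
    (fun i => ((hm i).const_mul θ).exp.stronglyMeasurable)
    (hi.comp (fun _ x => Real.exp (θ * x)) (fun _ => by fun_prop)) hint h1
  have h := aux_max hM.submartingale (fun j ω => by
    simp only [Pi.zero_apply, Finset.prod_apply]; positivity) (Real.exp_pos (θ * u)) n
  have hI : ∀ j, ∫ ω, (∏ i ∈ Finset.range (j + 1), fun ω => Real.exp (θ * ξ i ω)) ω ∂μ = 1 := by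
    intro j
    have := hM.setIntegral_eq (Nat.zero_le j) (s := univ) MeasurableSet.univ
    simp only [setIntegral_univ] at this
    rw [← this]; simpa using h1 0
  rw [hI] at h
  have e : {ω | ∃ k ≤ n, Real.exp (θ * u) ≤ (∏ i ∈ Finset.range (k + 1), fun ω => Real.exp (θ * ξ i ω)) ω}
     = {ω | ∃ k ≤ n, u ≤ ∑ i ∈ Finset.range (k + 1), ξ i ω} := by
    ext ω
    simp only [Finset.prod_apply, ← Real.exp_sum, Real.exp_le_exp, ← Finset.mul_sum, mem_ofPred_eq,
      mul_le_mul_iff_right₀ hθ]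
  rw [e] at h
  simpa [Real.exp_neg] using h

lemma aux_kolm {Ω : Type*} [MeasurableSpace Ω] {μ : Measure Ω} [IsProbabilityMeasure μ]
    {ξ : ℕ → Ω → ℝ} (hm : ∀ i, Measurable (ξ i)) (hi : iIndepFun ξ μ)
    (hint : ∀ i, Integrable (ξ i) μ)
    (h1 : ∀ i, ∫ ω, ξ i ω ∂μ = 0) {a : ℝ} (ha : 0 < a) (n : ℕ) :
    μ {ω | ∃ k ≤ n, ∑ i ∈ Finset.range (k + 1), ξ i ω ≤ -a} ≤
      ENNReal.ofReal ((∫ ω, |∑ i ∈ Finset.range (n + 1), ξ i ω| ∂μ) / a) := by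
  have hM := aux_sum_mart (fun i => (hm i).stronglyMeasurable) hi hint h1
  have hS := hM.neg.submartingale.pos
  have h := aux_max hS (fun j ω => by simp) ha n
  refine le_trans (measure_mono ?_) (h.trans (ENNReal.ofReal_le_ofReal ?_))
  · rintro ω ⟨k, hk, hle⟩
    refine ⟨k, hk, ?_⟩
    simp only [Pi.posPart_apply, Pi.neg_apply, Finset.sum_apply]
    exact le_trans (by linarith) (le_posPart _)
  · gcongr
    · exact hS.integrable n
    · exact (integrable_finsetSum _ fun i _ => hint i).abs
    · intro ω
      simp only [Pi.posPart_apply, Pi.neg_apply, Finset.sum_apply]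
      rw [posPart_def]
      exact sup_le (neg_le_abs _) (abs_nonneg _)

lemma aux_int_right {Ω : Type*} [MeasurableSpace Ω] {μ : Measure Ω} [IsProbabilityMeasure μ]
    {A B : Ω → ℝ} (hA : Measurable A) (hB : Measurable B) (hAB : IndepFun A B μ)
    (h : Integrable (A + B) μ) : Integrable B μ := by
  have h1 : Integrable (fun p : ℝ × ℝ => p.1 + p.2) ((μ.map A).prod (μ.map B)) := by
    rw [← (indepFun_iff_map_prod_eq_prod_map_map hA.aemeasurable hB.aemeasurable).1 hAB]
    rw [integrable_map_measure (by fun_prop) (by fun_prop)]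
    exact h
  have : IsProbabilityMeasure (μ.map A) := Measure.isProbabilityMeasure_map hA.aemeasurable
  have : IsProbabilityMeasure (μ.map B) := Measure.isProbabilityMeasure_map hB.aemeasurable
  obtain ⟨x, hx⟩ := h1.prod_right_ae.exists
  have h2 : Integrable (fun y : ℝ => y) (μ.map B) := by
    have := hx.sub (integrable_const x)
    refine this.congr (Eventually.of_forall fun y => by simp)
  rw [integrable_map_measure (by fun_prop) (by fun_prop)] at h2
  exact h2

lemma aux_indep {Ω : Type*} [MeasurableSpace Ω] {μ : Measure Ω} {X : ℝ → Ω → ℝ}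
    (hincr : ∀ (n : ℕ) (t : Fin (n + 1) → ℝ), (∀ i, 0 ≤ t i) → StrictMono t →
      iIndepFun
        (fun i : Fin n => fun ω => X (t i.succ) ω - X (t i.castSucc) ω) μ)
    {h : ℝ} (hh : 0 < h) :
    iIndepFun (fun (i : ℕ) ω => X (((i + 1 : ℕ) : ℝ) * h) ω - X ((i : ℝ) * h) ω) μ := by
  rw [iIndepFun_iff_finset]
  intro s
  have := hincr (s.sup id + 1) (fun i => (i : ℝ) * h) (fun i => by positivity)
    (fun i j hij => by
      have : ((i : ℕ) : ℝ) < (j : ℕ) := by exact_mod_cast hij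
      simp only; gcongr)
  refine this.precomp (g := fun i : s => (⟨(i : ℕ), Nat.lt_succ_of_le (Finset.le_sup (f := id) i.2)⟩ : Fin _)) ?_
  intro i j hij
  exact Subtype.ext (congrArg Fin.val hij :)

lemma aux_ident {Ω : Type*} [MeasurableSpace Ω] {μ : Measure Ω} {X : ℝ → Ω → ℝ}
    (hmeas : ∀ t : ℝ, Measurable (X t))
    (hstat : ∀ s t : ℝ, 0 ≤ s → s ≤ t →
      Measure.map (fun ω => X t ω - X s ω) μ = Measure.map (X (t - s)) μ)
    {h : ℝ} (hh : 0 < h) (i : ℕ) :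
    IdentDistrib (fun ω => X (((i + 1 : ℕ) : ℝ) * h) ω - X ((i : ℝ) * h) ω) (X h) μ μ := by
  refine ⟨by fun_prop, by fun_prop, ?_⟩
  rw [hstat _ _ (by positivity) (by gcongr; simp)]
  congr 2
  push_cast; ring

lemma aux_tele {Ω : Type*} (X : ℝ → Ω → ℝ) (h : ℝ) (n : ℕ) (ω : Ω) :
    ∑ i ∈ Finset.range n, (X (((i + 1 : ℕ) : ℝ) * h) ω - X ((i : ℝ) * h) ω)
      = X (n * h) ω - X 0 ω := by
  rw [Finset.sum_range_sub (fun i : ℕ => X ((i:ℝ) * h) ω)]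
  simp

lemma aux_tele' {Ω : Type*} (X : ℝ → Ω → ℝ) (h : ℝ) (n : ℕ) :
    ∑ i ∈ Finset.range n, (fun ω => X (((i + 1 : ℕ) : ℝ) * h) ω - X ((i : ℝ) * h) ω)
      = fun ω => X (n * h) ω - X 0 ω := by
  ext ω
  rw [Finset.sum_apply, aux_tele]

/-- mgf facts on the grid -/
lemma aux_mgf {Ω : Type*} [MeasurableSpace Ω] {μ : Measure Ω} [IsProbabilityMeasure μ]
    {X : ℝ → Ω → ℝ}
    (hmeas : ∀ t : ℝ, Measurable (X t))
    (hX0 : ∀ᵐ ω ∂μ, X 0 ω = 0)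
    (hstat : ∀ s t : ℝ, 0 ≤ s → s ≤ t →
      Measure.map (fun ω => X t ω - X s ω) μ = Measure.map (X (t - s)) μ)
    (hincr : ∀ (n : ℕ) (t : Fin (n + 1) → ℝ), (∀ i, 0 ≤ t i) → StrictMono t →
      iIndepFun
        (fun i : Fin n => fun ω => X (t i.succ) ω - X (t i.castSucc) ω) μ)
    {h : ℝ} (hh : 0 < h) (n : ℕ) (θ : ℝ) :
    mgf (X (n * h)) μ θ = mgf (X h) μ θ ^ n := by
  have hi := aux_indep hincr hh
  have e := hi.mgf_sum (t := θ) (fun i => by fun_prop) (Finset.range n)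
  rw [aux_tele'] at e
  rw [Finset.prod_congr rfl (fun i _ => mgf_congr_of_identDistrib _ _ (aux_ident hmeas hstat hh i) θ)] at e
  simp only [Finset.prod_const, Finset.card_range] at e
  rw [← e]
  refine integral_congr_ae ?_
  filter_upwards [hX0] with ω hω
  simp [hω]

lemma aux_expint {Ω : Type*} [MeasurableSpace Ω] {μ : Measure Ω} [IsProbabilityMeasure μ]
    {X : ℝ → Ω → ℝ}
    (hmeas : ∀ t : ℝ, Measurable (X t))
    (hX0 : ∀ᵐ ω ∂μ, X 0 ω = 0)
    (hstat : ∀ s t : ℝ, 0 ≤ s → s ≤ t →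
      Measure.map (fun ω => X t ω - X s ω) μ = Measure.map (X (t - s)) μ)
    (hincr : ∀ (n : ℕ) (t : Fin (n + 1) → ℝ), (∀ i, 0 ≤ t i) → StrictMono t →
      iIndepFun
        (fun i : Fin n => fun ω => X (t i.succ) ω - X (t i.castSucc) ω) μ)
    {h : ℝ} (hh : 0 < h) (n : ℕ) (hn : 0 < n) (θ : ℝ) :
    Integrable (fun ω => Real.exp (θ * X (n * h) ω)) μ ↔
      Integrable (fun ω => Real.exp (θ * X h ω)) μ := by
  have hi := aux_indep hincr hh
  have hid : ∀ i : ℕ, Integrable (fun ω => Real.exp (θ * X h ω)) μ ↔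
     Integrable (fun ω => Real.exp (θ * (X (((i + 1 : ℕ) : ℝ) * h) ω - X ((i : ℝ) * h) ω))) μ :=
    fun i => ((aux_ident hmeas hstat hh i).comp (u := fun x => Real.exp (θ * x))
      (by fun_prop)).integrable_iff.symm
  have hs : Integrable (fun ω => Real.exp (θ * X (n * h) ω)) μ ↔
      Integrable (fun ω => Real.exp (θ * (X (n * h) ω - X 0 ω))) μ := by
    refine integrable_congr ?_
    filter_upwards [hX0] with ω hω
    simp [hω]
  rw [hs]
  constructor
  · intro H
    obtain ⟨k, rfl⟩ : ∃ k, n = k + 1 := ⟨n - 1, by omega⟩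
    rw [hid k]
    have hk := hi.indepFun_sum_range_succ (fun i => by fun_prop) k
    rw [aux_tele'] at hk
    have hk2 := hk.comp (φ := fun x => Real.exp (θ * x)) (ψ := fun x => Real.exp (θ * x))
      (by fun_prop) (by fun_prop)
    refine hk2.symm.integrable_left_of_integrable_op (fun x y : ℝ => x * y) 1 (by simp)
      (by simp) ?_ (by fun_prop) (by fun_prop) ?_
    · refine H.congr (Eventually.of_forall fun ω => ?_)
      simp only [Function.comp]
      rw [← Real.exp_add]; congr 1; ring
    · intro H
      obtain ⟨ω, hω⟩ := H.exists
      exact (Real.exp_pos _).ne' hω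
  · intro H
    have := hi.integrable_exp_mul_sum (t := θ) (fun i => by fun_prop) (s := Finset.range n)
      (fun i _ => (hid i).1 H)
    rw [aux_tele'] at this
    exact this

lemma aux_mean {Ω : Type*} [MeasurableSpace Ω] {μ : Measure Ω} [IsProbabilityMeasure μ]
    {X : ℝ → Ω → ℝ}
    (hmeas : ∀ t : ℝ, Measurable (X t))
    (hX0 : ∀ᵐ ω ∂μ, X 0 ω = 0)
    (hstat : ∀ s t : ℝ, 0 ≤ s → s ≤ t →
      Measure.map (fun ω => X t ω - X s ω) μ = Measure.map (X (t - s)) μ)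
    (hincr : ∀ (n : ℕ) (t : Fin (n + 1) → ℝ), (∀ i, 0 ≤ t i) → StrictMono t →
      iIndepFun
        (fun i : Fin n => fun ω => X (t i.succ) ω - X (t i.castSucc) ω) μ)
    {h : ℝ} (hh : 0 < h) (n : ℕ) (hn : 0 < n)
    (hint : Integrable (X (n * h)) μ) (hmean : ∫ ω, X (n * h) ω ∂μ = 0) :
    Integrable (X h) μ ∧ ∫ ω, X h ω ∂μ = 0 := by
  have hi := aux_indep hincr hh
  have hs : X (n * h) =ᵐ[μ] (fun ω => X (n * h) ω - X 0 ω) := by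
    filter_upwards [hX0] with ω hω
    simp [hω]
  have hI : Integrable (X h) μ := by
    obtain ⟨k, rfl⟩ : ∃ k, n = k + 1 := ⟨n - 1, by omega⟩
    rw [← (aux_ident hmeas hstat hh k).integrable_iff]
    have hk := hi.indepFun_sum_range_succ (fun i => by fun_prop) k
    refine aux_int_right ?_ (by fun_prop) hk ?_
    · rw [aux_tele']; fun_prop
    · rw [aux_tele']
      refine (hint.congr hs).congr (Eventually.of_forall fun ω => ?_)
      simp
  refine ⟨hI, ?_⟩
  rw [integral_congr_ae hs] at hmean
  simp only [← aux_tele] at hmean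
  rw [integral_finsetSum _ (fun i _ => (aux_ident hmeas hstat hh i).integrable_iff.2 hI)] at hmean
  rw [Finset.sum_congr rfl (fun i _ => (aux_ident hmeas hstat hh i).integral_eq)] at hmean
  simpa [hn.ne'] using hmean

lemma aux_absmean {Ω : Type*} [MeasurableSpace Ω] {μ : Measure Ω} [IsProbabilityMeasure μ]
    {X : ℝ → Ω → ℝ}
    (hmeas : ∀ t : ℝ, Measurable (X t))
    (hstat : ∀ s t : ℝ, 0 ≤ s → s ≤ t →
      Measure.map (fun ω => X t ω - X s ω) μ = Measure.map (X (t - s)) μ)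
    {h : ℝ} (hh : 0 < h) (n : ℕ) 
    (hint : Integrable (X h) μ) :
    ∫ ω, |X (n * h) ω - X 0 ω| ∂μ ≤ n * ∫ ω, |X h ω| ∂μ := by
  have h1 : ∀ i : ℕ, Integrable (fun ω => |X (((i + 1 : ℕ) : ℝ) * h) ω - X ((i : ℝ) * h) ω|) μ :=
    fun i => ((aux_ident hmeas hstat hh i).integrable_iff.2 hint).abs
  have h2 : ∀ i : ℕ, ∫ ω, |X (((i + 1 : ℕ) : ℝ) * h) ω - X ((i : ℝ) * h) ω| ∂μ = ∫ ω, |X h ω| ∂μ :=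
    fun i => ((aux_ident hmeas hstat hh i).comp (u := fun x => |x|) (by fun_prop)).integral_eq
  calc ∫ ω, |X (n * h) ω - X 0 ω| ∂μ
      ≤ ∫ ω, ∑ i ∈ Finset.range n, |X (((i + 1 : ℕ) : ℝ) * h) ω - X ((i : ℝ) * h) ω| ∂μ := by
        refine integral_mono_of_nonneg (Eventually.of_forall fun ω => abs_nonneg _)
          (integrable_finsetSum _ fun i _ => h1 i) (Eventually.of_forall fun ω => ?_)
        simp only
        rw [← aux_tele]
        exact Finset.abs_sum_le_sum_abs _ _
    _ = _ := by
        rw [integral_finsetSum _ (fun i _ => h1 i), Finset.sum_congr rfl (fun i _ => h2 i)]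
        simp

lemma aux_seq {t : ℝ} (ht : 0 ≤ t) :
    Tendsto (fun k : ℕ => ((⌊t * 2 ^ k⌋₊ + 1 : ℕ) : ℝ) * ((2:ℝ) ^ k)⁻¹) atTop (nhdsWithin t (Ici t))
    ∧ ∀ k : ℕ, ((⌊t * 2 ^ k⌋₊ + 1 : ℕ) : ℝ) * ((2:ℝ) ^ k)⁻¹ ≤ t + 1 := by
  have hl : ∀ k : ℕ, t ≤ ((⌊t * 2 ^ k⌋₊ + 1 : ℕ) : ℝ) * ((2:ℝ) ^ k)⁻¹ := by
    intro k
    have := Nat.lt_floor_add_one (t * 2 ^ k)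
    rw [← div_eq_mul_inv, le_div_iff₀ (by positivity)]
    push_cast; linarith
  have hu : ∀ k : ℕ, ((⌊t * 2 ^ k⌋₊ + 1 : ℕ) : ℝ) * ((2:ℝ) ^ k)⁻¹ ≤ t + ((2:ℝ) ^ k)⁻¹ := by
    intro k
    have := Nat.floor_le (a := t * 2 ^ k) (by positivity)
    have h2 : t + ((2:ℝ) ^ k)⁻¹ = (t * 2 ^ k + 1) * ((2:ℝ) ^ k)⁻¹ := by field_simp
    rw [h2]
    gcongr
    push_cast; linarith
  have hz : Tendsto (fun k : ℕ => t + ((2:ℝ) ^ k)⁻¹) atTop (nhds t) := by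
    have : Tendsto (fun k : ℕ => ((2:ℝ) ^ k)⁻¹) atTop (nhds 0) :=
      tendsto_inv_atTop_zero.comp (tendsto_pow_atTop_atTop_of_one_lt (by norm_num))
    simpa using this.const_add t
  refine ⟨tendsto_nhdsWithin_iff.2 ⟨tendsto_of_tendsto_of_tendsto_of_le_of_le tendsto_const_nhds hz hl hu,
    Eventually.of_forall hl⟩, fun k => (hu k).trans ?_⟩
  have : ((2:ℝ) ^ k)⁻¹ ≤ 1 := inv_le_one_of_one_le₀ (one_le_pow₀ (by norm_num))
  linarith

lemma aux_grid_double (k j : ℕ) : ((2 * j + 1 + 1 : ℕ) : ℝ) * ((2:ℝ) ^ (k+1))⁻¹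
    = ((j + 1 : ℕ) : ℝ) * ((2:ℝ) ^ k)⁻¹ := by
  push_cast; rw [pow_succ]; field_simp; ring

lemma aux_sup {Ω : Type*} [MeasurableSpace Ω] {μ : Measure Ω} [IsProbabilityMeasure μ]
    {X : ℝ → Ω → ℝ}
    (hmeas : ∀ t : ℝ, Measurable (X t))
    (hX0 : ∀ᵐ ω ∂μ, X 0 ω = 0)
    (hpath : ∀ᵐ ω ∂μ, ∀ t : ℝ, 0 ≤ t → ContinuousWithinAt (fun s => X s ω) (Set.Ici t) t)
    (hstat : ∀ s t : ℝ, 0 ≤ s → s ≤ t →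
      Measure.map (fun ω => X t ω - X s ω) μ = Measure.map (X (t - s)) μ)
    (hincr : ∀ (n : ℕ) (t : Fin (n + 1) → ℝ), (∀ i, 0 ≤ t i) → StrictMono t →
      iIndepFun
        (fun i : Fin n => fun ω => X (t i.succ) ω - X (t i.castSucc) ω) μ)
    {θ : ℝ} (hθ : 0 < θ) (hint : Integrable (fun ω => Real.exp (θ * X 1 ω)) μ)
    (hfix : mgf (X 1) μ θ = Real.exp θ) (u : ℝ) :
    μ {ω | ∃ t : ℝ, 0 ≤ t ∧ u < X t ω - t} ≤ ENNReal.ofReal (Real.exp (-θ * u)) := by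
  set B : ℕ → Set Ω := fun k => {ω | ∃ j : ℕ, j ≤ k * 2 ^ k ∧
    u ≤ X (((j + 1 : ℕ) : ℝ) * ((2:ℝ) ^ k)⁻¹) ω - X 0 ω - ((j + 1 : ℕ) : ℝ) * ((2:ℝ) ^ k)⁻¹} with hB
  have hmono : Monotone B := by
    refine monotone_nat_of_le_succ fun k => ?_
    rintro ω ⟨j, hj, h⟩
    refine ⟨2 * j + 1, ?_, by rw [aux_grid_double]; exact h⟩
    have : 1 ≤ 2 ^ (k+1) := Nat.one_le_two_pow
    calc 2 * j + 1 ≤ 2 * (k * 2 ^ k) + 2 ^ (k+1) := by omega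
      _ = (k + 1) * 2 ^ (k+1) := by ring
  have hBk : ∀ k, μ (B k) ≤ ENNReal.ofReal (Real.exp (-θ * u)) := by
    intro k
    set h : ℝ := ((2:ℝ) ^ k)⁻¹ with hh
    have hpos : 0 < h := by positivity
    have h1 : ((2 ^ k : ℕ) : ℝ) * h = 1 := by rw [hh]; push_cast; field_simp
    have hI : Integrable (fun ω => Real.exp (θ * X h ω)) μ := by
      rw [← aux_expint hmeas hX0 hstat hincr hpos (2 ^ k) (by positivity), h1]; exact hint
    have hm : mgf (X h) μ θ = Real.exp (θ * h) := by
      have := aux_mgf hmeas hX0 hstat hincr hpos (2 ^ k) θ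
      rw [h1, hfix] at this
      have h3 : Real.exp θ = Real.exp (θ * h) ^ (2 ^ k) := by
        rw [← Real.exp_nat_mul]; congr 1
        linear_combination (-θ) * h1
      rw [h3] at this
      exact (pow_left_inj₀ mgf_nonneg (Real.exp_pos _).le (by positivity)).1 this.symm
    have hid := aux_ident hmeas hstat hpos
    have hV := aux_ville (μ := μ)
      (ξ := fun i ω => (X (((i + 1 : ℕ) : ℝ) * h) ω - X ((i : ℝ) * h) ω) - h)
      (fun i => by fun_prop)
      ((aux_indep hincr hpos).comp (fun _ x => x - h) (fun _ => by fun_prop)) hθ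
      (fun i => by
        have : Integrable (fun ω => Real.exp (θ * (X h ω - h))) μ := by
          simp_rw [mul_sub, Real.exp_sub]
          exact hI.div_const _
        exact ((hid i).comp (u := fun x => Real.exp (θ * (x - h))) (by fun_prop)).integrable_iff.2 this)
      (fun i => by
        have := ((hid i).comp (u := fun x => Real.exp (θ * (x - h))) (by fun_prop)).integral_eq
        simp only [Function.comp_def] at this
        rw [this]
        simp_rw [mul_sub, Real.exp_sub]
        rw [integral_div]
        have h5 : ∫ ω, Real.exp (θ * X h ω) ∂μ = Real.exp (θ * h) := hm
        rw [h5, div_self (Real.exp_pos _).ne'])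
      u (k * 2 ^ k)
    simp only [Finset.sum_sub_distrib] at hV
    simp only [← Finset.sum_sub_distrib (f := fun i => X (((i + 1 : ℕ) : ℝ) * h) _), aux_tele] at hV
    simpa [hB] using hV
  have hU : μ (⋃ k, B k) ≤ ENNReal.ofReal (Real.exp (-θ * u)) := by
    rw [hmono.measure_iUnion]
    exact iSup_le hBk
  refine (measure_mono_ae ?_).trans hU
  filter_upwards [hX0, hpath] with ω h0 hc
  rintro ⟨t, ht, htu⟩
  obtain ⟨hs, -⟩ := aux_seq ht
  have hl : Tendsto (fun s => X s ω - s) (nhdsWithin t (Ici t)) (nhds (X t ω - t)) :=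
    (hc t ht).sub continuousWithinAt_id
  have hev := (hl.comp hs).eventually (lt_mem_nhds htu)
  obtain ⟨k, hk1, hk2⟩ := (hev.and (eventually_ge_atTop ⌈t⌉₊)).exists
  refine mem_iUnion.2 ⟨k, ⌊t * 2 ^ k⌋₊, ?_, ?_⟩
  · refine Nat.floor_le_of_le ?_
    push_cast
    gcongr
    exact (Nat.le_ceil t).trans (by exact_mod_cast hk2)
  · rw [h0, sub_zero]; exact hk1.le

lemma aux_inf {Ω : Type*} [MeasurableSpace Ω] {μ : Measure Ω} [IsProbabilityMeasure μ]
    {X : ℝ → Ω → ℝ}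
    (hmeas : ∀ t : ℝ, Measurable (X t))
    (hX0 : ∀ᵐ ω ∂μ, X 0 ω = 0)
    (hstat : ∀ s t : ℝ, 0 ≤ s → s ≤ t →
      Measure.map (fun ω => X t ω - X s ω) μ = Measure.map (X (t - s)) μ)
    (hincr : ∀ (n : ℕ) (t : Fin (n + 1) → ℝ), (∀ i, 0 ≤ t i) → StrictMono t →
      iIndepFun
        (fun i : Fin n => fun ω => X (t i.succ) ω - X (t i.castSucc) ω) μ)
    (hint : Integrable (X 1) μ) (hmean : ∫ ω, X 1 ω ∂μ = 0)
    (N : ℕ) (hN : 0 < N) {a : ℝ} (ha : 0 < a) :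
    μ {ω | ∃ k j : ℕ, j < N * 2 ^ k ∧ X (((j + 1 : ℕ) : ℝ) * ((2:ℝ) ^ k)⁻¹) ω - X 0 ω ≤ -a}
      ≤ ENNReal.ofReal (N * (∫ ω, |X 1 ω| ∂μ) / a) := by
  set B : ℕ → Set Ω := fun k => {ω | ∃ j : ℕ, j < N * 2 ^ k ∧
    X (((j + 1 : ℕ) : ℝ) * ((2:ℝ) ^ k)⁻¹) ω - X 0 ω ≤ -a} with hB
  have hmono : Monotone B := by
    refine monotone_nat_of_le_succ fun k => ?_
    rintro ω ⟨j, hj, h⟩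
    refine ⟨2 * j + 1, ?_, by rw [aux_grid_double]; exact h⟩
    calc 2 * j + 1 < 2 * (N * 2 ^ k) := by omega
      _ = N * 2 ^ (k+1) := by ring
  have hBk : ∀ k, μ (B k) ≤ ENNReal.ofReal (N * (∫ ω, |X 1 ω| ∂μ) / a) := by
    intro k
    set h : ℝ := ((2:ℝ) ^ k)⁻¹ with hh
    have hpos : 0 < h := by positivity
    have h1 : ((2 ^ k : ℕ) : ℝ) * h = 1 := by rw [hh]; push_cast; field_simp
    obtain ⟨hI, hm⟩ := aux_mean hmeas hX0 hstat hincr hpos (2 ^ k) (by positivity)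
      (by rw [h1]; exact hint) (by rw [h1]; exact hmean)
    have hid := aux_ident hmeas hstat hpos
    have hV := aux_kolm (μ := μ)
      (ξ := fun i ω => (X (((i + 1 : ℕ) : ℝ) * h) ω - X ((i : ℝ) * h) ω))
      (fun i => by fun_prop)
      (aux_indep hincr hpos) (fun i => (hid i).integrable_iff.2 hI)
      (fun i => (hid i).integral_eq.trans hm) ha (N * 2 ^ k - 1)
    have hp : 0 < N * 2 ^ k := by positivity
    simp only [aux_tele] at hV
    have e : N * 2 ^ k - 1 + 1 = N * 2 ^ k := by omega
    rw [e] at hV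
    have e2 : ((N * 2 ^ k : ℕ) : ℝ) * h = N * 1 := by
      rw [← h1]; push_cast; ring
    rw [e2] at hV
    refine le_trans (measure_mono ?_) (hV.trans (ENNReal.ofReal_le_ofReal ?_))
    · rintro ω ⟨j, hj, h⟩
      exact ⟨j, by omega, h⟩
    · gcongr
      exact aux_absmean hmeas hstat one_pos N hint
  have hU : μ (⋃ k, B k) ≤ ENNReal.ofReal (N * (∫ ω, |X 1 ω| ∂μ) / a) := by
    rw [hmono.measure_iUnion]
    exact iSup_le hBk
  refine (measure_mono ?_).trans hU
  rintro ω ⟨k, hk⟩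
  exact mem_iUnion.2 ⟨k, hk⟩

lemma aux_der {f : ℝ → ℝ} {f' x : ℝ} (hf : HasDerivAt f f' x) :
    (f' < 0 → ∀ᶠ y in nhdsWithin x (Ioi x), f y < f x) ∧
    (0 < f' → ∀ᶠ y in nhdsWithin x (Iio x), f y < f x) := by
  have hs := hasDerivAt_iff_tendsto_slope.1 hf
  constructor
  · intro h
    have h1 := (hs.mono_left (nhdsWithin_mono x (fun y (hy : x < y) => hy.ne'))).eventually
      (gt_mem_nhds h)
    filter_upwards [h1, self_mem_nhdsWithin] with y hy hxy
    rw [slope_def_field, div_lt_iff₀ (sub_pos.2 hxy)] at hy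
    linarith
  · intro h
    have h1 := (hs.mono_left (nhdsWithin_mono x (fun y (hy : y < x) => hy.ne))).eventually
      (lt_mem_nhds h)
    filter_upwards [h1, self_mem_nhdsWithin] with y hy hxy
    rw [slope_def_field, lt_div_iff_of_neg (sub_neg.2 hxy)] at hy
    linarith

lemma aux_mpos {Ω : Type*} [MeasurableSpace Ω] {μ : Measure Ω} [IsProbabilityMeasure μ]
    {Z : Ω → ℝ} (hZ : Measurable Z) {θ : ℝ} (hθ : 0 < θ)
    (hin : θ ∈ interior (integrableExpSet Z μ)) (h1 : mgf Z μ θ = 1)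
    (hne : ¬ Z =ᵐ[μ] 0) : 0 < ∫ ω, Z ω * Real.exp (θ * Z ω) ∂μ := by
  have hI1 : Integrable (fun ω => Real.exp (θ * Z ω)) μ :=
    (interior_subset hin : θ ∈ integrableExpSet Z μ)
  have hI2 : Integrable (fun ω => Z ω * Real.exp (θ * Z ω)) μ := by
    simpa using integrable_pow_mul_exp_of_mem_interior_integrableExpSet hin 1
  set ψ : Ω → ℝ := fun ω => 1 - Real.exp (θ * Z ω) + θ * (Z ω * Real.exp (θ * Z ω)) with hψ
  have hIψ : Integrable ψ μ := ((integrable_const 1).sub hI1).add (hI2.const_mul θ)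
  have hval : ∫ ω, ψ ω ∂μ = θ * ∫ ω, Z ω * Real.exp (θ * Z ω) ∂μ := by
    have h1' : ∫ ω, Real.exp (θ * Z ω) ∂μ = 1 := h1
    rw [hψ, integral_add (by exact (integrable_const 1).sub hI1) (hI2.const_mul θ),
      integral_sub (integrable_const 1) hI1, h1', integral_const_mul]
    simp
  have hform : ∀ ω, ψ ω = (Real.exp (-(θ * Z ω)) - (-(θ * Z ω) + 1)) * Real.exp (θ * Z ω) := by
    intro ω
    have : Real.exp (-(θ * Z ω)) * Real.exp (θ * Z ω) = 1 := by rw [← Real.exp_add]; simp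
    simp only [hψ]
    linear_combination -this
  have h0 : ∀ ω, 0 ≤ ψ ω := by
    intro ω
    rw [hform]
    exact mul_nonneg (sub_nonneg.2 (Real.add_one_le_exp _)) (Real.exp_pos _).le
  have hpos : 0 < ∫ ω, ψ ω ∂μ := by
    refine lt_of_le_of_ne (integral_nonneg h0) fun h => hne ?_
    have := (integral_eq_zero_iff_of_nonneg h0 hIψ).1 h.symm
    filter_upwards [this] with ω hω
    by_contra hz
    simp only [Pi.zero_apply] at hω hz
    rw [hform] at hω
    have h2 : -(θ * Z ω) ≠ 0 := neg_ne_zero.2 (mul_ne_zero hθ.ne' hz)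
    have := Real.add_one_lt_exp h2
    exact (mul_pos (sub_pos.2 this) (Real.exp_pos _)).ne' hω
  rw [hval] at hpos
  exact (mul_pos_iff_of_pos_left hθ).1 hpos

lemma aux_cramer {Ω : Type*} [MeasurableSpace Ω] {μ : Measure Ω} [IsProbabilityMeasure μ]
    {Z : Ω → ℝ} {S : ℕ → Ω → ℝ} (hS : ∀ n, Measurable (S n)) {θ : ℝ} (hθ : 0 < θ)
    (hin : θ ∈ interior (integrableExpSet Z μ)) (h1 : mgf Z μ θ = 1)
    (hmgf : ∀ n t, mgf (S n) μ t = mgf Z μ t ^ n)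
    (hint : ∀ n t, t ∈ integrableExpSet Z μ → Integrable (fun ω => Real.exp (t * S n ω)) μ)
    {a b : ℝ} (ha : a < ∫ ω, Z ω * Real.exp (θ * Z ω) ∂μ)
    (hb : ∫ ω, Z ω * Real.exp (θ * Z ω) ∂μ < b) :
    ∀ᶠ n : ℕ in atTop, 1 / 2 * Real.exp (-(θ * b * n)) ≤ (μ {ω | a * n < S n ω}).toReal := by
  set m := ∫ ω, Z ω * Real.exp (θ * Z ω) ∂μ with hm
  have hd : HasDerivAt (mgf Z μ) m θ := hasDerivAt_mgf hin
  have hG : ∀ c : ℝ, HasDerivAt (fun y => mgf Z μ y * Real.exp (-(y - θ) * c)) (m - c) θ := by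
    intro c
    have h2 : HasDerivAt (fun y : ℝ => Real.exp (-(y - θ) * c)) (-c) θ := by
      have := ((((hasDerivAt_id θ).sub_const θ).neg).mul_const c).exp
      simpa using this
    have := hd.mul h2
    simp only [sub_self, neg_zero, zero_mul, Real.exp_zero, h1] at this
    exact this.congr_deriv (by ring)
  have hnb : ∀ᶠ y in nhds θ, y ∈ integrableExpSet Z μ := mem_interior_iff_mem_nhds.1 hin
  have hi1 := ((hG b |> aux_der).1 (by linarith)).and (hnb.filter_mono nhdsWithin_le_nhds)
  obtain ⟨y₁, ⟨hy1, hy1'⟩, hy1''⟩ := (hi1.and self_mem_nhdsWithin).exists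
  have hi2 := ((hG a |> aux_der).2 (by linarith)).and (hnb.filter_mono nhdsWithin_le_nhds)
  obtain ⟨y₂, ⟨hy2, hy2'⟩, hy2''⟩ := (hi2.and self_mem_nhdsWithin).exists
  simp only [sub_self, neg_zero, zero_mul, Real.exp_zero, h1, mul_one] at hy1 hy2
  set r₁ := mgf Z μ y₁ * Real.exp (-(y₁ - θ) * b)
  set r₂ := mgf Z μ y₂ * Real.exp (-(y₂ - θ) * a)
  have hr1 : 0 ≤ r₁ := mul_nonneg mgf_nonneg (Real.exp_pos _).le
  have hr2 : 0 ≤ r₂ := mul_nonneg mgf_nonneg (Real.exp_pos _).le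
  have key : ∀ n : ℕ, 1 ≤ r₁ ^ n + r₂ ^ n + Real.exp (θ * b * n) * (μ {ω | a * n < S n ω}).toReal := by
    intro n
    have hE : MeasurableSet {ω | a * n < S n ω} := measurableSet_lt measurable_const (hS n)
    have e0 : ∫ ω, Real.exp (θ * S n ω) ∂μ = 1 := by
      have := hmgf n θ
      rw [h1, one_pow] at this
      exact this
    have e1 : ∫ ω, Real.exp (y₁ * S n ω) * Real.exp (-(y₁ - θ) * b) ^ n ∂μ = r₁ ^ n := by
      rw [integral_mul_const, mul_pow, ← hmgf n]; rfl
    have e2 : ∫ ω, Real.exp (y₂ * S n ω) * Real.exp (-(y₂ - θ) * a) ^ n ∂μ = r₂ ^ n := by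
      rw [integral_mul_const, mul_pow, ← hmgf n]; rfl
    have e3 : ∫ ω, {ω | a * n < S n ω}.indicator (fun _ => Real.exp (θ * b * n)) ω ∂μ
        = Real.exp (θ * b * n) * (μ {ω | a * n < S n ω}).toReal := by
      rw [integral_indicator_const _ hE, smul_eq_mul, mul_comm]; rfl
    have i1 := (hint n y₁ hy1').mul_const (Real.exp (-(y₁ - θ) * b) ^ n)
    have i2 := (hint n y₂ hy2').mul_const (Real.exp (-(y₂ - θ) * a) ^ n)
    have i3 : Integrable ({ω | a * n < S n ω}.indicator (fun _ => Real.exp (θ * b * n))) μ :=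
      (integrable_const _).indicator hE
    rw [← e1, ← e2, ← e3, ← integral_add i1 i2, ← integral_add (by exact i1.add i2) i3, ← e0]
    refine integral_mono (hint n θ (interior_subset hin)) ((i1.add i2).add i3) fun ω => ?_
    simp only
    have p1 : 0 ≤ Real.exp (y₁ * S n ω) * Real.exp (-(y₁ - θ) * b) ^ n := by positivity
    have p2 : 0 ≤ Real.exp (y₂ * S n ω) * Real.exp (-(y₂ - θ) * a) ^ n := by positivity
    have p3 : 0 ≤ {ω | a * n < S n ω}.indicator (fun _ => Real.exp (θ * b * n)) ω :=
      indicator_nonneg (fun _ _ => (Real.exp_pos _).le) _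
    rcases le_or_gt (S n ω) (a * n) with hle | hgt
    · have : Real.exp (θ * S n ω) ≤ Real.exp (y₂ * S n ω) * Real.exp (-(y₂ - θ) * a) ^ n := by
        rw [← Real.exp_nat_mul, ← Real.exp_add, Real.exp_le_exp]
        have : 0 ≤ (θ - y₂) * (a * n - S n ω) :=
          mul_nonneg (sub_nonneg.2 (le_of_lt hy2'')) (sub_nonneg.2 hle)
        linarith
      linarith
    · rcases le_or_gt (S n ω) (b * n) with hle | hgt'
      · rw [indicator_of_mem (by exact hgt)]
        have : Real.exp (θ * S n ω) ≤ Real.exp (θ * b * n) := by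
          rw [Real.exp_le_exp, mul_assoc]; gcongr
        linarith
      · have : Real.exp (θ * S n ω) ≤ Real.exp (y₁ * S n ω) * Real.exp (-(y₁ - θ) * b) ^ n := by
          rw [← Real.exp_nat_mul, ← Real.exp_add, Real.exp_le_exp]
          have : 0 ≤ (y₁ - θ) * (S n ω - b * n) :=
            mul_nonneg (sub_nonneg.2 (le_of_lt hy1'')) (sub_nonneg.2 hgt'.le)
          linarith
        linarith
  have t1 := (tendsto_pow_atTop_nhds_zero_of_lt_one hr1 hy1).eventually (gt_mem_nhds (show (0:ℝ) < 1/4 by norm_num))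
  have t2 := (tendsto_pow_atTop_nhds_zero_of_lt_one hr2 hy2).eventually (gt_mem_nhds (show (0:ℝ) < 1/4 by norm_num))
  filter_upwards [t1, t2] with n h3 h4
  have := key n
  rw [Real.exp_neg, ← div_eq_mul_inv, div_le_iff₀ (Real.exp_pos _)]
  linarith

/-- Lower bound for the supremum. -/
lemma aux_lower {Ω : Type*} [MeasurableSpace Ω] {μ : Measure Ω} [IsProbabilityMeasure μ]
    {X : ℝ → Ω → ℝ}
    (hmeas : ∀ t : ℝ, Measurable (X t))
    (hX0 : ∀ᵐ ω ∂μ, X 0 ω = 0)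
    (hstat : ∀ s t : ℝ, 0 ≤ s → s ≤ t →
      Measure.map (fun ω => X t ω - X s ω) μ = Measure.map (X (t - s)) μ)
    (hincr : ∀ (n : ℕ) (t : Fin (n + 1) → ℝ), (∀ i, 0 ≤ t i) → StrictMono t →
      iIndepFun
        (fun i : Fin n => fun ω => X (t i.succ) ω - X (t i.castSucc) ω) μ)
    (hmean : ∫ ω, X 1 ω ∂μ = 0)
    {θ β : ℝ} (hθ : 0 < θ) (hβ : θ < β) (hint : Integrable (fun ω => Real.exp (β * X 1 ω)) μ)
    (hfix : mgf (X 1) μ θ = Real.exp θ) :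
    ∃ m : ℝ, 0 < m ∧ ∀ a b : ℝ, a < m → m < b →
    ∀ᶠ n : ℕ in atTop, 1 / 2 * Real.exp (-(θ * b * n)) ≤ (μ {ω | a * n < X n ω - n}).toReal := by
  set Z : Ω → ℝ := fun ω => X 1 ω - 1 with hZ
  have hZX : ∀ t : ℝ, Integrable (fun ω => Real.exp (t * Z ω)) μ ↔
      Integrable (fun ω => Real.exp (t * X 1 ω)) μ := by
    intro t
    simp only [hZ, mul_sub, Real.exp_sub]
    simp only [div_eq_mul_inv]
    exact integrable_mul_const_iff (IsUnit.mk0 _ (inv_ne_zero (Real.exp_pos _).ne')) _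
  have hZm : ∀ t : ℝ, mgf Z μ t = mgf (X 1) μ t / Real.exp t := by
    intro t
    simp only [hZ, mgf, mul_sub, Real.exp_sub, integral_div, mul_one]
  have hin : θ ∈ interior (integrableExpSet Z μ) := by
    have h0 : (0:ℝ) ∈ integrableExpSet Z μ := by simp [integrableExpSet]
    have hb : β ∈ integrableExpSet Z μ := (hZX β).2 hint
    have := (convex_integrableExpSet (X := Z) (μ := μ)).ordConnected.out h0 hb
    exact interior_mono this (by rw [interior_Icc]; exact ⟨hθ, hβ⟩)
  have h1 : mgf Z μ θ = 1 := by
    rw [hZm, hfix, div_self (Real.exp_pos _).ne']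
  have hne : ¬ Z =ᵐ[μ] 0 := by
    intro h
    have : ∫ ω, X 1 ω ∂μ = ∫ ω, (1:ℝ) ∂μ := by
      refine integral_congr_ae ?_
      filter_upwards [h] with ω hω
      simp only [hZ, Pi.zero_apply] at hω
      linarith
    rw [hmean] at this
    simp at this
  refine ⟨_, aux_mpos (by fun_prop) hθ hin h1 hne, fun a b ha hb => ?_⟩
  refine aux_cramer (S := fun n ω => X n ω - n) (fun n => by fun_prop) hθ hin h1 ?_ ?_ ha hb
  · intro n t
    have := aux_mgf hmeas hX0 hstat hincr one_pos n t
    rw [mul_one] at this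
    rw [hZm, div_pow, ← this, ← Real.exp_nat_mul, mul_comm (n:ℝ)]
    simp only [mgf, mul_sub, Real.exp_sub, integral_div]
  · intro n t ht
    have ht' : Integrable (fun ω => Real.exp (t * X 1 ω)) μ := (hZX t).1 ht
    simp only [mul_sub, Real.exp_sub]
    refine Integrable.div_const ?_ _
    rcases Nat.eq_zero_or_pos n with rfl | hn
    · refine (integrable_const (1:ℝ)).congr ?_
      filter_upwards [hX0] with ω hω
      simp [hω]
    · have := (aux_expint hmeas hX0 hstat hincr one_pos n hn t).2 ht'
      rwa [mul_one] at this

/-- **Corollary 3.9, case `T_u = o(u)`**. -/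
theorem inf_reflected_levy_light_tailed_small_window
    {Ω : Type*} [MeasureSpace Ω] [IsProbabilityMeasure (ℙ : Measure Ω)]
    (X : ℝ → Ω → ℝ)
    (hmeas : ∀ t : ℝ, Measurable (X t))
    (hX0 : ∀ᵐ ω ∂ℙ, X 0 ω = 0)
    (hpath : ∀ᵐ ω ∂ℙ, ∀ t : ℝ, 0 ≤ t →
      ContinuousWithinAt (fun s => X s ω) (Set.Ici t) t ∧
      (0 < t → ∃ l : ℝ, Tendsto (fun s => X s ω) (nhdsWithin t (Set.Iio t)) (nhds l)))
    (hstat : ∀ s t : ℝ, 0 ≤ s → s ≤ t →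
      Measure.map (fun ω => X t ω - X s ω) ℙ = Measure.map (X (t - s)) ℙ)
    (hincr : ∀ (n : ℕ) (t : Fin (n + 1) → ℝ), (∀ i, 0 ≤ t i) → StrictMono t →
      iIndepFun
        (fun i : Fin n => fun ω => X (t i.succ) ω - X (t i.castSucc) ω) ℙ)
    (hint : Integrable (X 1) ℙ)
    (hmean : ∫ ω, X 1 ω ∂ℙ = 0)
    (Qe : Ω → ℝ) (hQe_meas : Measurable Qe)
    (hQe_dist : Measure.map Qe ℙ
      = Measure.map (fun ω => ⨆ r : {r : ℝ // 0 ≤ r}, (X (r : ℝ) ω - (r : ℝ))) ℙ)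
    (hQe_indep : IndepFun Qe (fun ω => fun t : ℝ => X t ω) ℙ)
    (φ : ℝ → ℝ) (hφ : ∀ θ : ℝ, φ θ = Real.log (∫ ω, Real.exp (θ * X 1 ω) ∂ℙ))
    (ϑ : ℝ) (hϑ_pos : 0 < ϑ)
    (hϑ_lt : ∃ β : ℝ, ϑ < β ∧ Integrable (fun ω => Real.exp (β * X 1 ω)) ℙ)
    (hϑ_fix : φ ϑ = ϑ)
    (I : ℝ → ℝ) (hI : ∀ r : ℝ, I r = ⨆ θ : Set.Ioi (0:ℝ), ((θ : ℝ) * r - φ (θ : ℝ)))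
    (T : ℝ → ℝ) (hT_pos : ∀ u : ℝ, 0 < u → 0 < T u)
    (hTu : Tendsto (fun u : ℝ => T u / u) atTop (nhds 0)) :
    Tendsto (fun u : ℝ =>
        Real.log (ℙ {ω | u < Qe ω + ⨅ s : Set.Icc (0:ℝ) (T u), (X (s : ℝ) ω - (s : ℝ))}).toReal / u)
      atTop (nhds (-ϑ)) := by
  have hpc : ∀ᵐ ω ∂ℙ, ∀ t : ℝ, 0 ≤ t → ContinuousWithinAt (fun s => X s ω) (Set.Ici t) t := by
    filter_upwards [hpath] with ω h t ht using (h t ht).1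
  obtain ⟨β, hβ, hβint⟩ := hϑ_lt
  have hϑint : Integrable (fun ω => Real.exp (ϑ * X 1 ω)) ℙ := by
    have h0 : (0:ℝ) ∈ integrableExpSet (X 1) ℙ := by simp [integrableExpSet]
    exact (convex_integrableExpSet (X := X 1) (μ := ℙ)).ordConnected.out h0 hβint
      ⟨hϑ_pos.le, hβ.le⟩
  have hfix : mgf (X 1) ℙ ϑ = Real.exp ϑ := by
    have h1 := hφ ϑ
    rw [hϑ_fix] at h1
    have h2 : 0 < mgf (X 1) ℙ ϑ := mgf_pos hϑint
    have h3 : ϑ = Real.log (mgf (X 1) ℙ ϑ) := h1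
    rw [h3, Real.exp_log h2, ← h3]
  have hville := aux_sup hmeas hX0 hpc hstat hincr hϑ_pos hϑint hfix
  -- the supremum
  set W : Ω → ℝ := fun ω => ⨆ r : {r : ℝ // 0 ≤ r}, (X (r : ℝ) ω - (r : ℝ)) with hW
  have hWm : AEMeasurable W ℙ := by
    by_contra hn
    rw [Measure.map_of_not_aemeasurable hn] at hQe_dist
    have : IsProbabilityMeasure (Measure.map Qe ℙ) :=
      Measure.isProbabilityMeasure_map hQe_meas.aemeasurable
    exact this.ne_zero _ hQe_dist
  have hQW : ∀ v : ℝ, ℙ {ω | v < Qe ω} = ℙ {ω | v < W ω} := by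
    intro v
    have h1 := Measure.map_apply_of_aemeasurable (μ := ℙ) hQe_meas.aemeasurable (measurableSet_Ioi (a := v))
    have h2 := Measure.map_apply_of_aemeasurable hWm (measurableSet_Ioi (a := v))
    rw [hQe_dist, h2] at h1
    exact h1.symm
  have hbdd : ∀ᵐ ω ∂ℙ, BddAbove (range fun r : {r : ℝ // 0 ≤ r} => X (r : ℝ) ω - (r : ℝ)) := by
    rw [ae_iff]
    refine le_antisymm ?_ bot_le
    have hlim : Tendsto (fun n : ℕ => ENNReal.ofReal (Real.exp (-ϑ * n))) atTop (nhds 0) := by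
      rw [← ENNReal.ofReal_zero]
      refine ENNReal.tendsto_ofReal (Real.tendsto_exp_atBot.comp ?_)
      exact tendsto_natCast_atTop_atTop.const_mul_atTop_of_neg (neg_lt_zero.2 hϑ_pos)
    refine ge_of_tendsto' hlim fun n => le_trans (measure_mono ?_) (hville n)
    intro ω hω
    have hω' : ¬ BddAbove (range fun r : {r : ℝ // 0 ≤ r} => X (r : ℝ) ω - (r : ℝ)) := hω
    rw [not_bddAbove_iff] at hω'
    obtain ⟨_, ⟨r, rfl⟩, hr⟩ := hω' n
    exact ⟨r, r.2, hr⟩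
  have hupQ : ∀ u : ℝ, 0 < u → ℙ {ω | u < Qe ω} ≤ ENNReal.ofReal (Real.exp (-ϑ * u)) := by
    intro u hu
    rw [hQW]
    refine le_trans (measure_mono ?_) (hville u)
    intro ω hω
    have hω' : u < ⨆ r : {r : ℝ // 0 ≤ r}, (X (r : ℝ) ω - (r : ℝ)) := hω
    have : Nonempty {r : ℝ // 0 ≤ r} := ⟨⟨0, le_rfl⟩⟩
    obtain ⟨r, hr⟩ := exists_lt_of_lt_ciSup hω'
    exact ⟨r, r.2, hr⟩
  set p : ℝ → ℝ := fun u =>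
    (ℙ {ω | u < Qe ω + ⨅ s : Set.Icc (0:ℝ) (T u), (X (s : ℝ) ω - (s : ℝ))}).toReal with hp
  have hup : ∀ u : ℝ, 0 < u → p u ≤ Real.exp (-ϑ * u) := by
    intro u hu
    refine ENNReal.toReal_le_of_le_ofReal (Real.exp_pos _).le (le_trans (measure_mono_ae ?_) (hupQ u hu))
    filter_upwards [hX0] with ω h0 hω
    have hω' : u < Qe ω + ⨅ s : Set.Icc (0:ℝ) (T u), (X (s : ℝ) ω - (s : ℝ)) := hω
    have hle : ⨅ s : Set.Icc (0:ℝ) (T u), (X (s : ℝ) ω - (s : ℝ)) ≤ 0 := by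
      by_cases hb : BddBelow (range fun s : Set.Icc (0:ℝ) (T u) => X (s : ℝ) ω - (s : ℝ))
      · refine (ciInf_le hb ⟨0, le_rfl, (hT_pos u hu).le⟩).trans ?_
        simp [h0]
      · rw [Real.iInf_of_not_bddBelow hb]
    show u < Qe ω
    linarith
  obtain ⟨m, hm, hcr⟩ := aux_lower hmeas hX0 hstat hincr hmean hϑ_pos hβ hβint hfix
  set C : ℝ := ∫ ω, |X 1 ω| ∂ℙ with hC
  have hC0 : 0 ≤ C := integral_nonneg fun ω => abs_nonneg _
  -- the infimum event
  have hinf : ∀ ε : ℝ, 0 < ε → ∀ᶠ u in atTop,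
      1 / 2 * (ℙ {ω | (1 + ε) * u < Qe ω}).toReal ≤ p u := by
    intro ε hε
    have hsm : ∀ᶠ u in atTop, T u / u < ε / (2 * (2 * C + 1)) :=
      hTu.eventually (gt_mem_nhds (by positivity))
    filter_upwards [hsm, eventually_gt_atTop 0, eventually_gt_atTop (4 * (2 * C + 1) / ε)] with u hu1 hu0 hu2
    set N : ℕ := ⌈T u⌉₊ + 1 with hN
    have hT0 := hT_pos u hu0
    have hN1 : T u + 1 ≤ N := by
      have := Nat.le_ceil (T u); push_cast [hN]; linarith
    have hN2 : (N:ℝ) ≤ T u + 2 := by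
      have := Nat.ceil_lt_add_one hT0.le; push_cast [hN]; linarith
    have hN3 : (N:ℝ) * (2 * C + 1) < ε * u := by
      rw [div_lt_div_iff₀ hu0 (by positivity)] at hu1
      rw [div_lt_iff₀ hε] at hu2
      nlinarith
    have hN0 : (0:ℝ) < N := by linarith
    have ha : 0 < ε * u - N := by nlinarith
    set A : Set (ℝ → ℝ) := {f | ∀ k j : ℕ, j < N * 2 ^ k →
      -(ε * u - N) < f (((j + 1 : ℕ) : ℝ) * ((2:ℝ) ^ k)⁻¹) - f 0} with hA
    have hAm : MeasurableSet A := by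
      have : A = ⋂ (k : ℕ) (j : ℕ) (_ : j < N * 2 ^ k),
          {f : ℝ → ℝ | -(ε * u - N) < f (((j + 1 : ℕ) : ℝ) * ((2:ℝ) ^ k)⁻¹) - f 0} := by
        ext f; simp [hA]
      rw [this]
      refine MeasurableSet.iInter fun k => MeasurableSet.iInter fun j => MeasurableSet.iInter fun _ => ?_
      exact measurableSet_lt measurable_const (by fun_prop)
    have hproc : Measurable (fun ω => fun t : ℝ => X t ω) := measurable_pi_lambda _ hmeas
    have hAc : ℙ ((fun ω => fun t : ℝ => X t ω) ⁻¹' A)ᶜ ≤ ENNReal.ofReal (1/2) := by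
      refine le_trans (measure_mono ?_) ((aux_inf hmeas hX0 hstat hincr hint hmean N (by omega) ha).trans
        (ENNReal.ofReal_le_ofReal ?_))
      · intro ω hω
        have hω' : ¬ ∀ k j : ℕ, j < N * 2 ^ k →
          -(ε * u - N) < X (((j + 1 : ℕ) : ℝ) * ((2:ℝ) ^ k)⁻¹) ω - X 0 ω := hω
        push Not at hω'
        obtain ⟨k, j, h1, h2⟩ := hω'
        exact ⟨k, j, h1, h2⟩
      · rw [div_le_iff₀ ha]
        change (N:ℝ) * C ≤ _
        linarith
    have hAp : 1 / 2 ≤ (ℙ ((fun ω => fun t : ℝ => X t ω) ⁻¹' A)).toReal := by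
      have h1 := prob_compl_eq_one_sub (μ := ℙ) (hproc hAm)
      have h2 := measureReal_compl (μ := ℙ) (hproc hAm)
      have h3 : (ℙ ((fun ω => fun t : ℝ => X t ω) ⁻¹' A)ᶜ).toReal ≤ 1 / 2 :=
        ENNReal.toReal_le_of_le_ofReal (by norm_num) hAc
      simp only [measureReal_def, measure_univ, ENNReal.toReal_one] at h2
      linarith
    have hind := hQe_indep.measure_inter_preimage_eq_mul _ _ (measurableSet_Ioi (a := (1+ε)*u)) hAm
    have hsub : ℙ (Qe ⁻¹' Ioi ((1+ε)*u) ∩ (fun ω => fun t : ℝ => X t ω) ⁻¹' A) ≤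
        ℙ {ω | u < Qe ω + ⨅ s : Set.Icc (0:ℝ) (T u), (X (s : ℝ) ω - (s : ℝ))} := by
      refine measure_mono_ae ?_
      filter_upwards [hX0, hpc] with ω h0 hc
      rintro ⟨hq, hAω⟩
      have hq' : (1 + ε) * u < Qe ω := hq
      have hA' : ∀ k j : ℕ, j < N * 2 ^ k →
          -(ε * u - N) < X (((j + 1 : ℕ) : ℝ) * ((2:ℝ) ^ k)⁻¹) ω - X 0 ω := hAω
      have : Nonempty (Set.Icc (0:ℝ) (T u)) := ⟨⟨0, le_rfl, hT0.le⟩⟩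
      have hge : -(ε * u) ≤ ⨅ s : Set.Icc (0:ℝ) (T u), (X (s : ℝ) ω - (s : ℝ)) := by
        refine le_ciInf fun s => ?_
        obtain ⟨t, ht0, htT⟩ := s
        simp only
        by_contra hlt
        push Not at hlt
        obtain ⟨hs, hs1⟩ := aux_seq ht0
        have hl : Tendsto (fun s => X s ω - s) (nhdsWithin t (Ici t)) (nhds (X t ω - t)) :=
          (hc t ht0).sub continuousWithinAt_id
        obtain ⟨k, hk⟩ := ((hl.comp hs).eventually (gt_mem_nhds hlt)).exists
        have hk' := hs1 k
        simp only [Function.comp] at hk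
        have hj : ⌊t * 2 ^ k⌋₊ < N * 2 ^ k := by
          rw [Nat.floor_lt (by positivity)]
          push_cast
          gcongr
          linarith
        have := hA' k _ hj
        rw [h0] at this
        linarith
      show u < Qe ω + _
      linarith
    have h5 := ENNReal.toReal_mono (measure_ne_top _ _) hsub
    rw [hind, ENNReal.toReal_mul] at h5
    refine le_trans ?_ h5
    rw [mul_comm]
    refine mul_le_mul le_rfl hAp (by norm_num) ENNReal.toReal_nonneg
  have hlow : ∀ c : ℝ, ϑ < c → ∀ᶠ u in atTop, Real.exp (-c * u) ≤ p u := by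
    intro c hc
    obtain ⟨ε, hεc, hε⟩ : ∃ ε : ℝ, ϑ * (1 + ε) ^ 3 < c ∧ 0 < ε := by
      have hcont : Tendsto (fun x : ℝ => ϑ * (1 + x) ^ 3) (nhdsWithin 0 (Ioi 0)) (nhds (ϑ * (1 + 0) ^ 3)) :=
        (Continuous.tendsto (by fun_prop) 0).mono_left nhdsWithin_le_nhds
      have h := (hcont.eventually (gt_mem_nhds (show ϑ * (1 + 0) ^ 3 < c by simpa using hc))).and
        self_mem_nhdsWithin
      obtain ⟨ε, h1, h2⟩ := h.exists
      exact ⟨ε, h1, h2⟩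
    set a : ℝ := m / (1 + ε) with ha
    set b : ℝ := m * (1 + ε) with hb
    have ha0 : 0 < a := by positivity
    have hb0 : 0 < b := by positivity
    have ham : a < m := by rw [ha, div_lt_iff₀ (by positivity)]; nlinarith
    have hbm : m < b := by rw [hb]; nlinarith
    have htend : Tendsto (fun u : ℝ => ⌈(1 + ε) * u / a⌉₊) atTop atTop := by
      refine tendsto_nat_ceil_atTop.comp ?_
      refine Tendsto.atTop_div_const ha0 (tendsto_id.const_mul_atTop (by positivity))
    have hev := htend.eventually (hcr a b ham hbm)
    have hfin : ∀ᶠ u : ℝ in atTop, Real.exp (-(c - ϑ * (1+ε)^3) * u) < 1 / 4 * Real.exp (-(ϑ * b)) := by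
      have : Tendsto (fun u : ℝ => Real.exp (-(c - ϑ * (1+ε)^3) * u)) atTop (nhds 0) :=
        Real.tendsto_exp_atBot.comp (tendsto_id.const_mul_atTop_of_neg (by linarith))
      exact this.eventually (gt_mem_nhds (by positivity))
    filter_upwards [hev, hinf ε hε, hfin, eventually_gt_atTop 0] with u h1 h2 h3 hu
    set n : ℕ := ⌈(1 + ε) * u / a⌉₊ with hn
    have hn1 : (1 + ε) * u ≤ a * n := by
      have := Nat.le_ceil ((1 + ε) * u / a)
      rw [div_le_iff₀ ha0] at this
      linarith
    have hn2 : (n:ℝ) ≤ (1 + ε) * u / a + 1 := (Nat.ceil_lt_add_one (by positivity)).le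
    have h4 : (ℙ {ω | a * n < X n ω - n}).toReal ≤ (ℙ {ω | (1 + ε) * u < Qe ω}).toReal := by
      refine ENNReal.toReal_mono (measure_ne_top _ _) ?_
      rw [hQW]
      refine measure_mono_ae ?_
      filter_upwards [hbdd] with ω hω hlt
      have hlt' : a * n < X n ω - n := hlt
      have := le_ciSup hω ⟨(n:ℝ), Nat.cast_nonneg n⟩
      show (1 + ε) * u < ⨆ r : {r : ℝ // 0 ≤ r}, (X (r : ℝ) ω - (r : ℝ))
      simp only at this
      linarith
    have h5 : Real.exp (-(ϑ * b)) * Real.exp (-(ϑ * (1+ε)^3) * u) ≤ Real.exp (-(ϑ * b * n)) := by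
      rw [← Real.exp_add, Real.exp_le_exp]
      have h6 : ϑ * b * n ≤ ϑ * b * ((1 + ε) * u / a + 1) := by gcongr
      have h7 : ϑ * b * ((1 + ε) * u / a + 1) = ϑ * (1+ε)^3 * u + ϑ * b := by
        rw [ha, hb]; field_simp
      linarith
    have h8 : Real.exp (-c * u) = Real.exp (-(c - ϑ * (1+ε)^3) * u) * Real.exp (-(ϑ * (1+ε)^3) * u) := by
      rw [← Real.exp_add]; congr 1; ring
    rw [h8]
    have h9 := mul_le_mul_of_nonneg_right h3.le (Real.exp_pos (-(ϑ * (1+ε)^3) * u)).le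
    linarith
  rw [tendsto_order]
  constructor
  · intro x hx
    obtain ⟨c, hc1, hc2⟩ := exists_between (show ϑ < -x by linarith)
    filter_upwards [hlow c hc1, eventually_gt_atTop 0] with u h1 hu
    rw [lt_div_iff₀ hu]
    have h2 : -c * u ≤ Real.log (p u) :=
      (Real.le_log_iff_exp_le (lt_of_lt_of_le (Real.exp_pos _) h1)).2 h1
    nlinarith
  · intro x hx
    filter_upwards [hlow (ϑ + 1) (by linarith), eventually_gt_atTop 0] with u h1 hu
    rw [div_lt_iff₀ hu]
    have h2 : Real.log (p u) ≤ -ϑ * u :=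
      (Real.log_le_iff_le_exp (lt_of_lt_of_le (Real.exp_pos _) h1)).2 (hup u hu)
    nlinarith
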